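/- Let β1, β2 > 0, set θ = β2/β1, let α > 0 with θ + α(1 - θ) > 0, and take Q3(p) = 1 - (1-p)^θ with quantile density q3(p) = θ(1-p)^{θ-1} (arising when X1 and X2 are Pareto II with quantile functions Q_i(p) = (1-p)^{-1/β_i} - 1). Then for every u ∈ (0,1), the past-lifetime relative information generating function satisfies J_α*(u) = Q3(u)^{α-1}/u^α · ∫₀^u q3(p)^{1-α} dp = ((1 - (1-u)^θ)^{α-1}/u^α) · θ^{1-α} · (1 - (1-u)^{θ + α(1-θ)})/(θ + α(1-θ)). -/

import Mathlib

open MeasureTheory Set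

/-- For `c > 0` and `u > 0`, the integral of `(1-p)^(c-1)` over `(0,u)`. -/
theorem setIntegral_Ioo_one_sub_rpow {c u : ℝ} (hc : 0 < c) (hu : 0 < u) :
    ∫ p in Ioo (0:ℝ) u, (1 - p) ^ (c - 1) = (1 - (1 - u) ^ c) / c := by
  rw [← integral_Ioc_eq_integral_Ioo, ← intervalIntegral.integral_of_le hu.le,
    intervalIntegral.integral_comp_sub_left (fun x : ℝ => x ^ (c - 1)) 1,
    integral_rpow (Or.inl (by linarith))]
  simp

/-- The past-lifetime relative information generating function for two Pareto II
distributions with quantile functions `Q_i(p) = (1-p)^(-1/β_i) - 1`, where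
`θ = β2/β1`, `Q3(p) = 1 - (1-p)^θ` and `q3(p) = θ(1-p)^(θ-1)`: for `u ∈ (0,1)`,
`J_α*(u) = (1-(1-u)^θ)^(α-1)/u^α ⬝ θ^(1-α) ⬝ (1-(1-u)^(θ+α(1-θ)))/(θ+α(1-θ))`. -/
theorem past_relative_info_gen_paretoII
    (b1 b2 θ α : ℝ) (hb1 : 0 < b1) (hb2 : 0 < b2) (hθ : θ = b2 / b1)
    (hα : 0 < α) (hden : 0 < θ + α * (1 - θ))
    (u : ℝ) (hu : u ∈ Ioo (0:ℝ) 1) :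
    (1 - (1 - u) ^ θ) ^ (α - 1) / u ^ α
        * ∫ p in Ioo (0:ℝ) u, (θ * (1 - p) ^ (θ - 1)) ^ (1 - α)
      = (1 - (1 - u) ^ θ) ^ (α - 1) / u ^ α * θ ^ (1 - α)
          * ((1 - (1 - u) ^ (θ + α * (1 - θ))) / (θ + α * (1 - θ))) := by
  have hθ_pos : 0 < θ := hθ ▸ div_pos hb2 hb1
  have integrand_eq : ∀ p ∈ Ioo (0:ℝ) u, (θ * (1 - p) ^ (θ - 1)) ^ (1 - α)
      = θ ^ (1 - α) * (1 - p) ^ (θ + α * (1 - θ) - 1) := by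
    intro p hp
    have hp_pos : 0 < 1 - p := by linarith [hp.2, hu.2]
    rw [Real.mul_rpow hθ_pos.le (Real.rpow_nonneg hp_pos.le _), ← Real.rpow_mul hp_pos.le]
    ring_nf
  rw [setIntegral_congr_fun measurableSet_Ioo integrand_eq, integral_const_mul,
    setIntegral_Ioo_one_sub_rpow hden hu.1, mul_assoc]
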